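/- Let π be a permutation having at least one element that is not a left-to-right minimum; let m be its number of left-to-right minima, let p+1 be the position (from the left) of its leftmost non-left-to-right-minimum element, and let v be the number of left-to-right minima whose value is less than the value of its largest non-left-to-right-minimum element. Let τ be the unique permutation of length m+1 whose (p+1)-th entry equals v+1 and whose remaining m entries (the values {1,…,m+1}∖{v+1}) appear in decreasing order. Then, under the bidirectional replacement 123 ↔ 13★, π ≡ τ, and every permutation equivalent to π has length at least m+1; thus τ is the primitive permutation of π under 123 ↔ 13★. -/

import Mathlib

/-!
Pattern-replacement equivalences between permutations of different lengths
(arXiv:1309.4802). A ★-pattern is encoded as a `List (Option ℕ)`, where `none`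
is the placeholder ★ and `some k` an integer entry.
-/

/-- A ★-pattern / star-string entry: `none` is ★, `some k` an integer `k`. -/
abbrev SPat := List (Option ℕ)

/-- The integer entries of a star-string, in order. -/
def ints (ρ : SPat) : List ℕ := ρ.filterMap id

/-- Two lists of naturals are order-isomorphic. -/
def OrdIso (u v : List ℕ) : Prop :=
  u.length = v.length ∧
  ∀ i j, i < u.length → j < u.length → (u.getD i 0 < u.getD j 0 ↔ v.getD i 0 < v.getD j 0)

/-- A valid string of distinct positive integers and ★'s. -/
def StarStr (ρ : SPat) : Prop := (ints ρ).Nodup ∧ ∀ k ∈ ints ρ, 0 < k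

/-- `r` (entry by entry) forms a copy of the ★-pattern `δ`: ★'s in the same
positions, and the integer entries order-isomorphic. -/
def IsCopy (r δ : SPat) : Prop :=
  r.length = δ.length ∧
  (∀ i, (r.getD i none = none ↔ δ.getD i none = none)) ∧
  OrdIso (ints r) (ints δ)

/-- `Repl a b ρ₁ ρ₂` : `ρ₂` is obtained from `ρ₁` by replacing an occurrence of `a`
as a (not necessarily contiguous) substring of `ρ₁` by `b`, entry by entry at the
same positions. -/
inductive Repl : SPat → SPat → SPat → SPat → Prop
  | nil : Repl [] [] [] []
  | keep {a b ρ₁ ρ₂} (x : Option ℕ) : Repl a b ρ₁ ρ₂ → Repl a b (x :: ρ₁) (x :: ρ₂)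
  | repl {a b ρ₁ ρ₂} (x y : Option ℕ) :
      Repl a b ρ₁ ρ₂ → Repl (x :: a) (y :: b) (x :: ρ₁) (y :: ρ₂)

/-- `π` is a permutation of `1, …, n` (as a list). -/
def IsPermList (π : List ℕ) : Prop := π.Perm (List.range' 1 π.length)

/-- `σ` is a result of the replacement `α → β` applied to the permutation `π`:
(1) `ρ₁` is `π` renumbered (order-isomorphically) with ★'s inserted anywhere;
(2) a substring `a` of `ρ₁` forming a copy of `α` is replaced (in place) by a
string `b` that is a copy of `β`, whose integers meet `ρ₁` only inside `a`, and
which agrees with `a` on the integer entries common to `α` and `β`;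
(3) dropping ★'s and renumbering gives the permutation `σ`. -/
def IsResult (α β : SPat) (π σ : List ℕ) : Prop :=
  ∃ ρ₁ ρ₂ a b : SPat,
    StarStr ρ₁ ∧ OrdIso π (ints ρ₁) ∧
    IsCopy a α ∧
    StarStr b ∧ IsCopy b β ∧
    (∀ k ∈ ints b, k ∈ ints ρ₁ → k ∈ ints a) ∧
    (∀ i j x, α.getD i none = some x → β.getD j none = some x →
      a.getD i none = b.getD j none) ∧
    Repl a b ρ₁ ρ₂ ∧
    IsPermList σ ∧ OrdIso (ints ρ₂) σ

/-- Equivalence under the bidirectional replacement `α ↔ β`: a finite sequence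
of `α → β` and `β → α` replacements. -/
def PermEquiv (α β : SPat) (π σ : List ℕ) : Prop :=
  Relation.ReflTransGen (fun τ υ => IsResult α β τ υ ∨ IsResult β α τ υ) π σ

/-- `π` is isolated under `α ↔ β`: no other permutation is equivalent to it. -/
def Isolated (α β : SPat) (π : List ℕ) : Prop :=
  ∀ σ : List ℕ, IsPermList σ → PermEquiv α β π σ → σ = π

/-- The identity permutation `1 2 ⋯ n`. -/
def idPerm (n : ℕ) : List ℕ := List.range' 1 n

/-- The reverse identity permutation `n (n-1) ⋯ 1`. -/
def ridPerm (n : ℕ) : List ℕ := (List.range' 1 n).reverse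

def pat123 : SPat := [some 1, some 2, some 3]
def pat132 : SPat := [some 1, some 3, some 2]
def patS32 : SPat := [none, some 3, some 2]
def pat3S2 : SPat := [some 3, none, some 2]
def pat32S : SPat := [some 3, some 2, none]
def patS31 : SPat := [none, some 3, some 1]
def pat3S1 : SPat := [some 3, none, some 1]
def pat31S : SPat := [some 3, some 1, none]
def patS21 : SPat := [none, some 2, some 1]
def pat2S1 : SPat := [some 2, none, some 1]
def pat21S : SPat := [some 2, some 1, none]
def pat12S : SPat := [some 1, some 2, none]
def pat1S3 : SPat := [some 1, none, some 3]
def patS23 : SPat := [none, some 2, some 3]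
def patS12 : SPat := [none, some 1, some 2]
def pat23S : SPat := [some 2, some 3, none]
def pat13S : SPat := [some 1, some 3, none]
def pat1S2 : SPat := [some 1, none, some 2]

/-- The entry at (0-indexed) position `i` of `π` is a left-to-right minimum. -/
def IsLRMin (π : List ℕ) (i : ℕ) : Prop := ∀ j < i, π.getD i 0 < π.getD j 0

instance (π : List ℕ) (i : ℕ) : Decidable (IsLRMin π i) := by
  unfold IsLRMin; infer_instance

/-- The number of left-to-right minima of `π`. -/
def numLRMin (π : List ℕ) : ℕ :=
  ((List.range π.length).filter fun i => decide (IsLRMin π i)).length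

/-- `π` has at least one element that is not a left-to-right minimum. -/
def HasNonMin (π : List ℕ) : Prop := ∃ i < π.length, ¬ IsLRMin π i

/-- The 0-indexed position of the leftmost non-left-to-right-minimum, if any. -/
def leftNonMin (π : List ℕ) : Option ℕ :=
  (List.range π.length).find? fun i => ! decide (IsLRMin π i)

/-- The 0-indexed position of the rightmost non-left-to-right-minimum, if any. -/
def rightNonMin (π : List ℕ) : Option ℕ :=
  (List.range π.length).reverse.find? fun i => ! decide (IsLRMin π i)

/-- The values of the non-left-to-right-minimum entries of `π`. -/
def nonMinVals (π : List ℕ) : List ℕ :=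
  ((List.range π.length).filter fun i => ! decide (IsLRMin π i)).map fun i => π.getD i 0

/-- The largest non-left-to-right-minimum value of `π`. -/
def maxNonMin (π : List ℕ) : ℕ := (nonMinVals π).foldr max 0

/-- The smallest non-left-to-right-minimum value of `π`. -/
def minNonMin (π : List ℕ) : ℕ := (nonMinVals π).foldr min π.length

/-- The number of left-to-right minima of `π` whose value is less than the
value of the largest non-left-to-right-minimum element. -/
def vStatMax (π : List ℕ) : ℕ :=
  ((List.range π.length).filter fun i =>
    decide (IsLRMin π i) && decide (π.getD i 0 < maxNonMin π)).length

/-- The number of left-to-right minima of `π` whose value is less than the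
value of the smallest non-left-to-right-minimum element. -/
def vStatMin (π : List ℕ) : ℕ :=
  ((List.range π.length).filter fun i =>
    decide (IsLRMin π i) && decide (π.getD i 0 < minNonMin π)).length

/-- The permutation of length `m + 1` whose `(p+1)`-th entry (1-indexed; index `p`
0-indexed) is `v + 1` and whose remaining entries appear in decreasing order. -/
def tau13 (m p v : ℕ) : List ℕ :=
  (((List.range' 1 (m + 1)).filter fun x => decide (x ≠ v + 1)).reverse).insertIdx p (v + 1)

/-- Left-to-right minima of `l`, given the elements `pre` to the left of it. -/
def lrm : List ℕ → List ℕ → List ℕ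
  | _, [] => []
  | pre, a :: t => if ∀ x ∈ pre, a < x then a :: lrm (pre ++ [a]) t else lrm (pre ++ [a]) t

/-- Elements of `l` that are not left-to-right minima, given the elements `pre` to the left. -/
def nrm : List ℕ → List ℕ → List ℕ
  | _, [] => []
  | pre, a :: t => if ∀ x ∈ pre, a < x then nrm (pre ++ [a]) t else a :: nrm (pre ++ [a]) t

theorem lrm_append (pre s t : List ℕ) : lrm pre (s ++ t) = lrm pre s ++ lrm (pre ++ s) t := by
  induction s generalizing pre with
  | nil => simp [lrm]
  | cons a s ih =>
    simp only [List.cons_append, lrm, ih]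
    split_ifs <;> simp

theorem nrm_append (pre s t : List ℕ) : nrm pre (s ++ t) = nrm pre s ++ nrm (pre ++ s) t := by
  induction s generalizing pre with
  | nil => simp [nrm]
  | cons a s ih =>
    simp only [List.cons_append, nrm, ih]
    split_ifs <;> simp

theorem lrm_congr (l : List ℕ) : ∀ (pre pre' : List ℕ),
    (∀ a, (∀ x ∈ pre, a < x) ↔ (∀ x ∈ pre', a < x)) → lrm pre l = lrm pre' l := by
  induction l with
  | nil => intros; rfl
  | cons b l ih =>
    intro pre pre' h
    have : lrm (pre ++ [b]) l = lrm (pre' ++ [b]) l := by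
      apply ih
      intro a
      have := h a
      simp only [List.mem_append, List.mem_singleton, or_imp, forall_and, forall_eq, this]
    simp only [lrm, h b, this]

theorem nrm_congr (l : List ℕ) : ∀ (pre pre' : List ℕ),
    (∀ a, (∀ x ∈ pre, a < x) ↔ (∀ x ∈ pre', a < x)) → nrm pre l = nrm pre' l := by
  induction l with
  | nil => intros; rfl
  | cons b l ih =>
    intro pre pre' h
    have : nrm (pre ++ [b]) l = nrm (pre' ++ [b]) l := by
      apply ih
      intro a
      have := h a
      simp only [List.mem_append, List.mem_singleton, or_imp, forall_and, forall_eq, this]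
    simp only [nrm, h b, this]

theorem lrm_nrm_length (l : List ℕ) : ∀ pre, (lrm pre l).length + (nrm pre l).length = l.length := by
  induction l with
  | nil => simp [lrm, nrm]
  | cons a l ih =>
    intro pre
    have := ih (pre ++ [a])
    simp only [lrm, nrm]
    split_ifs <;> simp <;> omega

theorem lrm_eq_of_nrm_nil (l : List ℕ) : ∀ pre, nrm pre l = [] → lrm pre l = l := by
  induction l with
  | nil => simp [lrm]
  | cons a l ih =>
    intro pre
    simp only [lrm, nrm]
    split_ifs
    · intro h; rw [ih _ h]
    · simp

theorem lrm_sorted (l : List ℕ) : ∀ pre, (lrm pre l).Pairwise (· > ·) ∧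
    ∀ a ∈ lrm pre l, ∀ x ∈ pre, a < x := by
  induction l with
  | nil => simp [lrm]
  | cons a l ih =>
    intro pre
    obtain ⟨h1, h2⟩ := ih (pre ++ [a])
    simp only [lrm]
    split_ifs with h
    · refine ⟨List.pairwise_cons.2 ⟨fun b hb => h2 b hb a (by simp), h1⟩, ?_⟩
      intro b hb x hx
      rcases List.mem_cons.1 hb with rfl | hb
      · exact h x hx
      · exact h2 b hb x (by simp [hx])
    · exact ⟨h1, fun b hb x hx => h2 b hb x (by simp [hx])⟩

theorem getD_app_left (P R : List ℕ) (i : ℕ) (h : i < P.length) :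
    (P ++ R).getD i 0 = P.getD i 0 := List.getD_append _ _ _ _ h

theorem isLRMin_append (P R : List ℕ) (i : ℕ) (h : i < P.length) :
    IsLRMin (P ++ R) i ↔ IsLRMin P i := by
  unfold IsLRMin
  rw [getD_app_left _ _ _ h]
  constructor
  · intro H j hj
    have := H j hj
    rwa [getD_app_left _ _ _ (by omega)] at this
  · intro H j hj
    rw [getD_app_left _ _ _ (by omega)]
    exact H j hj

theorem isLRMin_length (P R : List ℕ) (a : ℕ) :
    IsLRMin (P ++ a :: R) P.length ↔ ∀ x ∈ P, a < x := by
  unfold IsLRMin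
  have e : (P ++ a :: R).getD P.length 0 = a := by simp
  rw [e]
  constructor
  · intro H x hx
    obtain ⟨j, hj, rfl⟩ := List.getElem_of_mem hx
    have := H j hj
    rwa [getD_app_left _ _ _ hj, List.getD_eq_getElem _ _ hj] at this
  · intro H j hj
    rw [getD_app_left _ _ _ hj, List.getD_eq_getElem _ _ hj]
    exact H _ (List.getElem_mem _)

theorem lrm_eq (l : List ℕ) :
    ((List.range l.length).filter fun i => decide (IsLRMin l i)).map (fun i => l.getD i 0)
      = lrm [] l := by
  induction l using List.reverseRecOn with
  | nil => rfl
  | append_singleton l a ih =>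
    rw [lrm_append, ← ih]
    simp only [List.length_append, List.length_singleton, List.range_succ, List.filter_append,
      List.map_append]
    congr 1
    · rw [List.filter_congr (q := fun i => decide (IsLRMin l i))]
      · apply List.map_congr_left
        intro i hi
        simp only [List.mem_filter, List.mem_range] at hi
        exact getD_app_left _ _ _ hi.1
      · intro i hi
        rw [List.mem_range] at hi
        simp [isLRMin_append l [a] i hi]
    · have := isLRMin_length l [] a
      by_cases h : ∀ x ∈ l, a < x
      · have h2 : IsLRMin (l ++ [a]) l.length := this.2 h
        simp only [List.filter, h2, decide_true, List.nil_append, lrm, if_pos h, List.map_cons,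
          List.map_nil]
        simp
      · have h2 : ¬ IsLRMin (l ++ [a]) l.length := by rwa [this]
        simp only [List.filter, h2, decide_false, List.nil_append, lrm, h, if_false, List.map_nil]

theorem nrm_eq (l : List ℕ) : nonMinVals l = nrm [] l := by
  induction l using List.reverseRecOn with
  | nil => rfl
  | append_singleton l a ih =>
    rw [nrm_append, ← ih]
    unfold nonMinVals
    simp only [List.length_append, List.length_singleton, List.range_succ, List.filter_append,
      List.map_append]
    congr 1
    · rw [List.filter_congr (q := fun i => !decide (IsLRMin l i))]
      · apply List.map_congr_left
        intro i hi
        simp only [List.mem_filter, List.mem_range] at hi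
        exact getD_app_left _ _ _ hi.1
      · intro i hi
        rw [List.mem_range] at hi
        simp [isLRMin_append l [a] i hi]
    · have := isLRMin_length l [] a
      by_cases h : ∀ x ∈ l, a < x
      · have h2 : IsLRMin (l ++ [a]) l.length := this.2 h
        simp only [List.filter, h2, decide_true, Bool.not_true, List.nil_append, nrm, if_pos h,
          List.map_nil]
      · have h2 : ¬ IsLRMin (l ++ [a]) l.length := by rwa [this]
        simp [List.filter, h2, nrm, h]

theorem numLRMin_eq (l : List ℕ) : numLRMin l = (lrm [] l).length := by
  rw [← lrm_eq]; simp [numLRMin]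

theorem vStatMax_eq (l : List ℕ) :
    vStatMax l = ((lrm [] l).filter fun a => decide (a < (nrm [] l).foldr max 0)).length := by
  rw [← lrm_eq, ← nrm_eq, List.filter_map, List.length_map, List.filter_filter]
  unfold vStatMax maxNonMin
  congr 1
  apply List.filter_congr
  intro i _
  simp [Bool.and_comm]

theorem leftNonMin_split (P R : List ℕ) (y : ℕ) (h : ∃ x ∈ P, x < y) :
    leftNonMin (P ++ y :: R) = (leftNonMin P).or (some P.length) := by
  have e : (P ++ y :: R).length = P.length + (1 + R.length) := by simp; omega
  unfold leftNonMin
  rw [e, List.range_add, List.find?_append]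
  have h1 : ¬ IsLRMin (P ++ y :: R) P.length := by
    rw [isLRMin_length]; push Not
    obtain ⟨x, hx, h⟩ := h
    exact ⟨x, hx, h.le⟩
  have e1 : List.range (1 + R.length) = 0 :: (List.range R.length).map Nat.succ := by
    rw [Nat.add_comm, List.range_succ_eq_map]
  congr 1
  · apply List.find?_congr
    intro i hi
    rw [List.mem_range] at hi
    simp [isLRMin_append P _ i hi]
  · rw [e1]; simp [h1]

/-- One `123 → 13★` replacement on the level of lists of numbers. -/
def Red (l l' : List ℕ) : Prop :=
  ∃ P C D y z, (∃ x ∈ P, x < y) ∧ y < z ∧ l = P ++ y :: (C ++ z :: D) ∧ l' = P ++ z :: (C ++ D)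

/-- Equality of the three statistics. -/
def SameInv (l l' : List ℕ) : Prop :=
  numLRMin l = numLRMin l' ∧ leftNonMin l = leftNonMin l' ∧ vStatMax l = vStatMax l'

theorem foldr_max_append (s t : List ℕ) :
    (s ++ t).foldr max 0 = max (s.foldr max 0) (t.foldr max 0) := by
  induction s with
  | nil => simp
  | cons a s ih => simp [ih, max_assoc]

theorem Red.sameInv {l l' : List ℕ} (h : Red l l') : SameInv l l' := by
  obtain ⟨P, C, D, y, z, ⟨x, hx, hxy⟩, hyz, rfl, rfl⟩ := h
  have hy : ¬ ∀ u ∈ P, y < u := fun H => by have := H x hx; omega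
  have hz : ¬ ∀ u ∈ P, z < u := fun H => by have := H x hx; omega
  have hz' : ¬ ∀ u ∈ P ++ [y] ++ C, z < u := fun H => by have := H x (by simp [hx]); omega
  have c1 : ∀ a, (∀ u ∈ P ++ [y], a < u) ↔ (∀ u ∈ P ++ [z], a < u) := by
    intro a
    simp only [List.mem_append, List.mem_singleton, or_imp, forall_and, forall_eq]
    constructor
    · rintro ⟨h1, h2⟩; exact ⟨h1, by omega⟩
    · rintro ⟨h1, h2⟩; have := h1 x hx; exact ⟨h1, by omega⟩
  have c2 : ∀ a, (∀ u ∈ P ++ [y] ++ C ++ [z], a < u) ↔ (∀ u ∈ P ++ [z] ++ C, a < u) := by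
    intro a
    simp only [List.mem_append, List.mem_singleton, or_imp, forall_and, forall_eq]
    constructor
    · rintro ⟨⟨⟨h1, h2⟩, h3⟩, h4⟩; exact ⟨⟨h1, h4⟩, h3⟩
    · rintro ⟨⟨h1, h2⟩, h3⟩; have := h1 x hx; exact ⟨⟨⟨h1, by omega⟩, h3⟩, h2⟩
  have eL : lrm [] (P ++ y :: (C ++ z :: D)) = lrm [] (P ++ z :: (C ++ D)) := by
    rw [lrm_append, lrm_append]
    simp only [List.nil_append, lrm, hy, hz, if_false, lrm_append, hz']
    rw [lrm_congr C _ _ c1, lrm_congr D _ _ c2]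
  have eN : (nrm [] (P ++ y :: (C ++ z :: D))).foldr max 0
      = (nrm [] (P ++ z :: (C ++ D))).foldr max 0 := by
    rw [nrm_append, nrm_append]
    simp only [List.nil_append, nrm, hy, hz, if_false, nrm_append, hz']
    rw [nrm_congr C _ _ c1, nrm_congr D _ _ c2]
    simp only [foldr_max_append, List.foldr_cons]
    omega
  refine ⟨by rw [numLRMin_eq, numLRMin_eq, eL], ?_, by rw [vStatMax_eq, vStatMax_eq, eL, eN]⟩
  rw [leftNonMin_split _ _ _ ⟨x, hx, hxy⟩, leftNonMin_split _ _ _ ⟨x, hx, hxy.trans hyz⟩]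

theorem OrdIso.symm {u v : List ℕ} (h : OrdIso u v) : OrdIso v u :=
  ⟨h.1.symm, fun i j hi hj => (h.2 i j (by rw [h.1]; exact hi) (by rw [h.1]; exact hj)).symm⟩

theorem OrdIso.isLRMin {u v : List ℕ} (h : OrdIso u v) {i : ℕ} (hi : i < u.length) :
    IsLRMin u i ↔ IsLRMin v i := by
  unfold IsLRMin
  apply forall_congr'; intro j
  apply forall_congr'; intro hj
  exact h.2 i j hi (by omega)

theorem lt_foldr_max (l : List ℕ) (a : ℕ) : a < l.foldr max 0 ↔ ∃ b ∈ l, a < b := by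
  induction l with
  | nil => simp
  | cons c l ih => simp [ih]

theorem OrdIso.sameInv {u v : List ℕ} (h : OrdIso u v) : SameInv u v := by
  refine ⟨?_, ?_, ?_⟩
  · unfold numLRMin
    rw [← h.1]
    congr 1
    apply List.filter_congr
    intro i hi
    simp [h.isLRMin (List.mem_range.1 hi)]
  · unfold leftNonMin
    rw [← h.1]
    apply List.find?_congr
    intro i hi
    simp [h.isLRMin (List.mem_range.1 hi)]
  · unfold vStatMax
    rw [← h.1]
    congr 1
    apply List.filter_congr
    intro i hi
    have hi' := List.mem_range.1 hi
    have : u.getD i 0 < maxNonMin u ↔ v.getD i 0 < maxNonMin v := by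
      simp only [maxNonMin, lt_foldr_max, nonMinVals, List.mem_map, List.mem_filter, List.mem_range,
        ← h.1]
      constructor
      · rintro ⟨_, ⟨j, ⟨hj, h1⟩, rfl⟩, h2⟩
        exact ⟨_, ⟨j, ⟨hj, by simpa [← h.isLRMin hj] using h1⟩, rfl⟩, (h.2 i j hi' hj).1 h2⟩
      · rintro ⟨_, ⟨j, ⟨hj, h1⟩, rfl⟩, h2⟩
        exact ⟨_, ⟨j, ⟨hj, by simpa [h.isLRMin hj] using h1⟩, rfl⟩, (h.2 i j hi' hj).2 h2⟩
    simp only [h.isLRMin hi', this]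

theorem SameInv.trans {a b c : List ℕ} (h : SameInv a b) (h' : SameInv b c) : SameInv a c :=
  ⟨h.1.trans h'.1, h.2.1.trans h'.2.1, h.2.2.trans h'.2.2⟩

theorem SameInv.symm {a b : List ℕ} (h : SameInv a b) : SameInv b a :=
  ⟨h.1.symm, h.2.1.symm, h.2.2.symm⟩

theorem repl_cons {u v : Option ℕ} {a b s t : SPat} (h : Repl (u :: a) (v :: b) s t) :
    ∃ P R1 R2, s = P ++ u :: R1 ∧ t = P ++ v :: R2 ∧ Repl a b R1 R2 := by
  generalize e1 : u :: a = a' at h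
  generalize e2 : v :: b = b' at h
  induction h with
  | nil => cases e1
  | keep x h ih =>
    obtain ⟨P, R1, R2, rfl, rfl, h3⟩ := ih e1 e2
    exact ⟨x :: P, R1, R2, rfl, rfl, h3⟩
  | repl x y h ih =>
    cases e1; cases e2
    exact ⟨[], _, _, rfl, rfl, h⟩

theorem repl_nil {a b s t : SPat} (h : Repl a b s t) (e : a = []) : s = t := by
  induction h with
  | nil => rfl
  | keep x h ih => rw [ih e]
  | repl x y h ih => cases e

theorem repl_three {u1 u2 u3 v1 v2 v3 : Option ℕ} {s t : SPat}
    (h : Repl [u1, u2, u3] [v1, v2, v3] s t) : ∃ A B C D,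
    s = A ++ u1 :: (B ++ u2 :: (C ++ u3 :: D)) ∧ t = A ++ v1 :: (B ++ v2 :: (C ++ v3 :: D)) := by
  obtain ⟨A, R1, R2, rfl, rfl, h1⟩ := repl_cons h
  obtain ⟨B, R3, R4, rfl, rfl, h2⟩ := repl_cons h1
  obtain ⟨C, R5, R6, rfl, rfl, h3⟩ := repl_cons h2
  rw [repl_nil h3 rfl]
  exact ⟨A, B, C, R6, rfl, rfl⟩

theorem copy123 {a : SPat} (h : IsCopy a pat123) :
    ∃ x y z, a = [some x, some y, some z] ∧ x < y ∧ y < z := by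
  obtain ⟨h1, h2, h3⟩ := h
  match a, h1 with
  | [a0, a1, a2], _ =>
    have k0 := h2 0
    have k1 := h2 1
    have k2 := h2 2
    match a0, a1, a2 with
    | none, _, _ => simp [pat123] at k0
    | _, none, _ => simp [pat123] at k1
    | _, _, none => simp [pat123] at k2
    | some x, some y, some z =>
      refine ⟨x, y, z, rfl, ?_, ?_⟩
      · have := (h3.2 0 1 (by simp [ints]) (by simp [ints])).2 (by simp [ints, pat123])
        simpa [ints] using this
      · have := (h3.2 1 2 (by simp [ints]) (by simp [ints])).2 (by simp [ints, pat123])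
        simpa [ints] using this

theorem copy13S {a : SPat} (h : IsCopy a pat13S) :
    ∃ x z, a = [some x, some z, none] ∧ x < z := by
  obtain ⟨h1, h2, h3⟩ := h
  match a, h1 with
  | [a0, a1, a2], _ =>
    have k0 := h2 0
    have k1 := h2 1
    have k2 := h2 2
    match a0, a1, a2 with
    | none, _, _ => simp [pat13S] at k0
    | _, none, _ => simp [pat13S] at k1
    | _, _, some _ => simp [pat13S] at k2
    | some x, some z, none =>
      refine ⟨x, z, rfl, ?_⟩
      · have := (h3.2 0 1 (by simp [ints]) (by simp [ints])).2 (by simp [ints, pat13S])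
        simpa [ints] using this

theorem ints_red (A B C D : SPat) (x y z : ℕ) (h1 : x < y) (h2 : y < z) :
    Red (ints (A ++ some x :: (B ++ some y :: (C ++ some z :: D))))
      (ints (A ++ some x :: (B ++ some z :: (C ++ none :: D)))) := by
  refine ⟨ints A ++ x :: ints B, ints C, ints D, y, z, ⟨x, by simp, h1⟩, h2, ?_, ?_⟩ <;>
    simp [ints]

theorem IsResult.sameInv {π σ : List ℕ} (h : IsResult pat123 pat13S π σ) : SameInv π σ := by
  obtain ⟨ρ₁, ρ₂, a, b, -, h1, ha, -, hb, -, hc, hr, -, h2⟩ := h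
  obtain ⟨x, y, z, rfl, hxy, hyz⟩ := copy123 ha
  obtain ⟨x', z', rfl, -⟩ := copy13S hb
  have e1 := hc 0 0 1 rfl rfl
  have e2 := hc 2 1 3 rfl rfl
  simp at e1 e2
  subst e1 e2
  obtain ⟨A, B, C, D, rfl, rfl⟩ := repl_three hr
  exact (h1.sameInv.trans (ints_red A B C D x y z hxy hyz).sameInv).trans h2.sameInv

theorem IsResult.sameInv' {π σ : List ℕ} (h : IsResult pat13S pat123 π σ) : SameInv π σ := by
  obtain ⟨ρ₁, ρ₂, a, b, -, h1, ha, -, hb, -, hc, hr, -, h2⟩ := h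
  obtain ⟨x, y, z, rfl, hxy, hyz⟩ := copy123 hb
  obtain ⟨x', z', rfl, -⟩ := copy13S ha
  have e1 := hc 0 0 1 rfl rfl
  have e2 := hc 1 2 3 rfl rfl
  simp at e1 e2
  subst e1 e2
  obtain ⟨A, B, C, D, rfl, rfl⟩ := repl_three hr
  exact (h1.sameInv.trans (ints_red A B C D _ y _ hxy hyz).sameInv.symm).trans h2.sameInv

theorem PermEquiv.sameInv {π σ : List ℕ} (h : PermEquiv pat123 pat13S π σ) : SameInv π σ := by
  induction h with
  | refl => exact ⟨rfl, rfl, rfl⟩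
  | tail _ h ih => exact ih.trans (h.elim IsResult.sameInv IsResult.sameInv')

theorem leftNonMin_some {l : List ℕ} {p : ℕ} (h : leftNonMin l = some p) :
    p < l.length ∧ ¬ IsLRMin l p ∧ ∀ j < p, IsLRMin l j := by
  unfold leftNonMin at h
  rw [List.find?_range_eq_some] at h
  simpa [and_comm, and_left_comm] using h

/-- Splitting at the leftmost element that is not a left-to-right minimum. -/
theorem split_left {l : List ℕ} {p : ℕ} (h : leftNonMin l = some p) :
    ∃ A y B, l = A ++ y :: B ∧ A.length = p ∧ nrm [] A = [] ∧ ¬ ∀ x ∈ A, y < x := by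
  obtain ⟨h1, h2, h3⟩ := leftNonMin_some h
  have e : l = l.take p ++ l[p] :: l.drop (p + 1) := by simp
  have hl : (l.take p).length = p := by simp; omega
  refine ⟨l.take p, l[p], l.drop (p + 1), e, hl, ?_, ?_⟩
  · rw [← nrm_eq]
    unfold nonMinVals
    simp only [List.map_eq_nil_iff, List.filter_eq_nil_iff, List.mem_range, hl]
    intro j hj
    have := h3 j hj
    rw [e, isLRMin_append _ _ _ (by omega)] at this
    simp [this]
  · rw [← isLRMin_length _ (l.drop (p + 1)), ← e, hl]; exact h2

theorem filter_range_lt (n w : ℕ) (h1 : 1 ≤ w) (h2 : w ≤ n + 1) :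
    ((List.range' 1 n).filter (fun a => decide (a < w))).length = w - 1 := by
  have : List.range' 1 n = List.range' 1 (w - 1) ++ List.range' w (n + 1 - w) := by
    have := List.range'_append_1 (s := 1) (m := w - 1) (n := n + 1 - w)
    rw [show 1 + (w - 1) = w by omega, show w - 1 + (n + 1 - w) = n by omega] at this
    exact this.symm
  rw [this, List.filter_append, List.filter_eq_self.2, List.filter_eq_nil_iff.2, List.append_nil,
    List.length_range']
  · intro a; rw [List.mem_range'_1]; simp; omega
  · intro a; rw [List.mem_range'_1]; simp; omega

theorem unique_tau {σ : List ℕ} {m p v : ℕ} (hσ : IsPermList σ) (hl : σ.length = m + 1)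
    (hm : numLRMin σ = m) (hp : leftNonMin σ = some p) (hv : vStatMax σ = v) :
    σ = tau13 m p v := by
  obtain ⟨A, w, B, rfl, rfl, hA, hw⟩ := split_left hp
  have hlen := lrm_nrm_length (A ++ w :: B) []
  rw [numLRMin_eq] at hm
  have eN : nrm [] (A ++ w :: B) = w :: nrm (A ++ [w]) B := by
    rw [nrm_append, hA]; simp [nrm, hw]
  have eB : nrm (A ++ [w]) B = [] := by
    rw [eN] at hlen
    simp only [List.length_cons] at hlen
    exact List.length_eq_zero_iff.1 (by omega)
  have eL : lrm [] (A ++ w :: B) = A ++ B := by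
    rw [lrm_append, lrm_eq_of_nrm_nil A _ hA]; simp [lrm, hw, lrm_eq_of_nrm_nil B _ eB]
  have hs := (lrm_sorted (A ++ w :: B) []).1
  rw [eL] at hs
  rw [vStatMax_eq, eL, eN, eB] at hv
  simp only [List.foldr_cons, List.foldr_nil, Nat.max_zero] at hv
  have hperm : (A ++ w :: B).Perm (List.range' 1 (m + 1)) := by
    have := hσ; unfold IsPermList at this; rwa [hl] at this
  have hperm2 : (w :: (A ++ B)).Perm (List.range' 1 (m + 1)) :=
    List.perm_middle.symm.trans hperm
  have hnd : (w :: (A ++ B)).Nodup := hperm2.nodup_iff.2 List.nodup_range'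
  have hwm : w ∈ List.range' 1 (m + 1) := hperm2.subset (by simp)
  rw [List.mem_range'_1] at hwm
  have hwv : w = v + 1 := by
    have q := (hperm2.filter (fun a => decide (a < w))).length_eq
    rw [filter_range_lt _ _ hwm.1 (by omega), List.filter_cons_of_neg (by simp), hv] at q
    omega
  have eAB : A ++ B = ((List.range' 1 (m + 1)).filter fun x => decide (x ≠ v + 1)).reverse := by
    apply List.Perm.eq_of_pairwise (le := (· > ·)) _ hs
    · rw [List.pairwise_reverse]
      exact (List.pairwise_lt_range').filter _
    · refine List.Perm.trans ?_ (List.reverse_perm _).symm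
      have q := hperm2.filter (fun x => decide (x ≠ v + 1))
      refine List.Perm.trans ?_ q
      rw [← hwv]
      have hw' := (List.nodup_cons.1 hnd).1
      rw [List.filter_cons_of_neg (by simp), List.filter_eq_self.2]
      intro a ha
      simp; rintro rfl; exact hw' ha
    · intro a b _ _ h1 h2; omega
  unfold tau13
  rw [← eAB, ← hwv]
  clear * -
  induction A with
  | nil => simp
  | cons a A ih => simpa using ih

/-- The rank of `a` in `l`. -/
def rnk (l : List ℕ) (a : ℕ) : ℕ := (l.filter fun b => decide (b ≤ a)).length

/-- Standardization of a list of distinct numbers. -/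
def std (l : List ℕ) : List ℕ := l.map (rnk l)

theorem rnk_mono (l : List ℕ) {a b : ℕ} (h : a ≤ b) : rnk l a ≤ rnk l b := by
  apply List.Sublist.length_le
  apply List.monotone_filter_right
  intro c hc
  simp only [decide_eq_true_eq] at hc ⊢
  omega

theorem rnk_lt (l : List ℕ) {a b : ℕ} (hb : b ∈ l) (h : a < b) : rnk l a < rnk l b := by
  have hs : (l.filter fun c => decide (c ≤ a)).Sublist (l.filter fun c => decide (c ≤ b)) := by
    apply List.monotone_filter_right
    intro c hc
    simp only [decide_eq_true_eq] at hc ⊢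
    omega
  refine lt_of_le_of_ne hs.length_le fun e => ?_
  have := hs.eq_of_length e
  have hb' : b ∈ l.filter fun c => decide (c ≤ b) := by simp [hb]
  rw [← this] at hb'
  simp at hb'
  omega

theorem std_ordIso (l : List ℕ) : OrdIso l (std l) := by
  refine ⟨by simp [std], fun i j hi hj => ?_⟩
  have h1 : (std l).getD i 0 = rnk l l[i] := by simp [std, hi]
  have h2 : (std l).getD j 0 = rnk l l[j] := by simp [std, hj]
  rw [h1, h2, List.getD_eq_getElem _ _ hi, List.getD_eq_getElem _ _ hj]
  constructor
  · exact rnk_lt l (List.getElem_mem _)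
  · intro h
    by_contra h'
    have := rnk_mono l (not_lt.1 h')
    omega

theorem std_perm {l : List ℕ} (h : l.Nodup) : IsPermList (std l) := by
  have hn : (std l).Nodup := by
    apply List.Nodup.map_on _ h
    intro x hx y hy e
    rcases lt_trichotomy x y with h | h | h
    · have := rnk_lt l hy h; omega
    · exact h
    · have := rnk_lt l hx h; omega
  unfold IsPermList
  apply List.Subperm.perm_of_length_le
  · apply List.subperm_of_subset hn
    intro a ha
    simp only [std, List.mem_map] at ha
    obtain ⟨b, hb, rfl⟩ := ha
    have h1 : rnk l b ≤ l.length := List.length_filter_le _ _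
    have h2 : 0 < rnk l b := List.length_pos_of_mem (a := b) (by simp [hb])
    rw [List.mem_range'_1]
    simp only [std, List.length_map]
    omega
  · simp

theorem std_double {π : List ℕ} (h : IsPermList π) : std (π.map (2 * ·)) = π := by
  unfold std
  rw [List.map_map]
  conv_rhs => rw [← List.map_id π]
  apply List.map_congr_left
  intro a ha
  have ha' := h.subset ha
  rw [List.mem_range'_1] at ha'
  simp only [Function.comp, rnk, List.filter_map, List.length_map, id]
  have q := (h.filter (fun b => decide (b < a + 1))).length_eq
  rw [filter_range_lt _ _ (by omega) (by omega)] at q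
  refine Eq.trans ?_ (q.trans (by omega))
  congr 1
  apply List.filter_congr
  intro b _
  simp only [Function.comp_apply]
  apply decide_eq_decide.2
  omega

/-- Distinct positive entries. -/
def Good (l : List ℕ) : Prop := l.Nodup ∧ ∀ k ∈ l, 0 < k

theorem Red.good {l l' : List ℕ} (h : Red l l') (hl : Good l) : Good l' := by
  obtain ⟨P, C, D, y, z, -, -, rfl, rfl⟩ := h
  have hp : (P ++ y :: (C ++ z :: D)).Perm (y :: (P ++ z :: (C ++ D))) := by
    refine List.perm_middle.trans (List.Perm.cons _ (List.Perm.append_left _ List.perm_middle))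
  exact ⟨(List.nodup_cons.1 (hp.nodup_iff.1 hl.1)).2,
    fun k hk => hl.2 k (hp.symm.subset (List.mem_cons_of_mem _ hk))⟩

theorem repl_refl (s : SPat) : Repl [] [] s s := by
  induction s with
  | nil => exact Repl.nil
  | cons x s ih => exact Repl.keep x ih

theorem repl_left {a b s t : SPat} (P : SPat) (h : Repl a b s t) :
    Repl a b (P ++ s) (P ++ t) := by
  induction P with
  | nil => exact h
  | cons x P ih => exact Repl.keep x ih

theorem mk_repl (u1 u2 u3 v1 v2 v3 : Option ℕ) (A B C D : SPat) :
    Repl [u1, u2, u3] [v1, v2, v3]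
      (A ++ u1 :: (B ++ u2 :: (C ++ u3 :: D))) (A ++ v1 :: (B ++ v2 :: (C ++ v3 :: D))) :=
  repl_left A (Repl.repl _ _ (repl_left B (Repl.repl _ _ (repl_left C
    (Repl.repl _ _ (repl_refl D))))))

theorem mk_copy123 {x y z : ℕ} (h1 : x < y) (h2 : y < z) :
    IsCopy [some x, some y, some z] pat123 := by
  refine ⟨rfl, ?_, rfl, ?_⟩
  · intro i
    match i with
    | 0 | 1 | 2 => simp [pat123]
    | n + 3 => simp [pat123]
  · intro i j hi hj
    simp only [ints, List.filterMap_cons, id, List.filterMap_nil, List.length_cons,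
      List.length_nil] at hi hj
    interval_cases i <;> interval_cases j <;> simp [ints, pat123] <;> omega

theorem mk_copy13S {x z : ℕ} (h1 : x < z) :
    IsCopy [some x, some z, none] pat13S := by
  refine ⟨rfl, ?_, rfl, ?_⟩
  · intro i
    match i with
    | 0 | 1 | 2 => simp [pat13S]
    | n + 3 => simp [pat13S]
  · intro i j hi hj
    simp only [ints, List.filterMap_cons, id, List.filterMap_nil, List.length_cons,
      List.length_nil] at hi hj
    interval_cases i <;> interval_cases j <;> simp [ints, pat13S] <;> omega

theorem ints_some (l : List ℕ) : ints (l.map some) = l := by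
  simp [ints]

theorem mk_agree (x y z : ℕ) : ∀ i j k, pat123.getD i none = some k → pat13S.getD j none = some k →
    ([some x, some y, some z] : SPat).getD i none = ([some x, some z, none] : SPat).getD j none := by
  intro i j k h1 h2
  match i, j with
  | 0, 0 => rfl
  | 0, 1 => simp [pat123, pat13S] at h1 h2; omega
  | 1, 0 => simp [pat123, pat13S] at h1 h2; omega
  | 1, 1 => simp [pat123, pat13S] at h1 h2; omega
  | 2, 0 => simp [pat123, pat13S] at h1 h2; omega
  | 2, 1 => rfl
  | n + 3, _ => simp [pat123] at h1
  | _, 2 => simp [pat13S] at h2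
  | _, n + 3 => simp [pat13S] at h2

theorem Red.equiv {l l' : List ℕ} (h : Red l l') (hl : Good l) :
    PermEquiv pat123 pat13S (std l) (std l') ∧ PermEquiv pat123 pat13S (std l') (std l) := by
  have hl' := h.good hl
  obtain ⟨P, C, D, y, z, ⟨x, hx, hxy⟩, hyz, e1, e2⟩ := h
  obtain ⟨A, B, rfl⟩ := List.append_of_mem hx
  let s1 : SPat := A.map some ++ some x :: (B.map some ++ some y :: (C.map some ++ some z :: D.map some))
  let s2 : SPat := A.map some ++ some x :: (B.map some ++ some z :: (C.map some ++ none :: D.map some))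
  have i1 : ints s1 = l := by simp [s1, ints, e1]
  have i2 : ints s2 = l' := by simp [s2, ints, e2]
  have iy : y ∉ l' := by
    have hp : l.Perm (y :: l') := by
      rw [e1, e2]
      refine List.perm_middle.trans (List.Perm.cons _ (List.Perm.append_left _ List.perm_middle))
    exact (List.nodup_cons.1 (hp.nodup_iff.1 hl.1)).1
  have px : 0 < x := hl.2 x (by simp [e1])
  constructor
  · refine Relation.ReflTransGen.single (Or.inl ⟨s1, s2, [some x, some y, some z],
      [some x, some z, none], ?_, ?_, mk_copy123 hxy hyz, ?_, mk_copy13S (hxy.trans hyz), ?_,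
      mk_agree x y z, mk_repl _ _ _ _ _ _ _ _ _ _, std_perm hl'.1, ?_⟩)
    · unfold StarStr; rw [i1]; exact hl
    · rw [i1]; exact (std_ordIso l).symm
    · constructor
      · simp [ints]; omega
      · simp [ints]; omega
    · intro k hk _
      simp [ints] at hk ⊢; tauto
    · rw [i2]; exact std_ordIso l'
  · refine Relation.ReflTransGen.single (Or.inr ⟨s2, s1, [some x, some z, none],
      [some x, some y, some z], ?_, ?_, mk_copy13S (hxy.trans hyz), ?_, mk_copy123 hxy hyz, ?_,
      fun i j k h1 h2 => (mk_agree x y z j i k h2 h1).symm,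
      mk_repl _ _ _ _ _ _ _ _ _ _, std_perm hl.1, ?_⟩)
    · unfold StarStr; rw [i2]; exact hl'
    · rw [i2]; exact (std_ordIso l').symm
    · constructor
      · simp [ints]; omega
      · simp [ints]; omega
    · intro k hk hk2
      rw [i2] at hk2
      simp [ints] at hk ⊢
      rcases hk with rfl | rfl | rfl
      · simp
      · exact absurd hk2 iy
      · simp
    · rw [i1]; exact std_ordIso l

theorem nrm_ne_nil (l : List ℕ) : ∀ pre, nrm pre l ≠ [] →
    ∃ C z D, l = C ++ z :: D ∧ ¬ ∀ x ∈ pre ++ C, z < x := by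
  induction l with
  | nil => simp [nrm]
  | cons a l ih =>
    intro pre h
    by_cases ha : ∀ x ∈ pre, a < x
    · simp only [nrm, if_pos ha] at h
      obtain ⟨C, z, D, rfl, hz⟩ := ih _ h
      exact ⟨a :: C, z, D, rfl, by simpa using hz⟩
    · exact ⟨[], a, l, rfl, by simpa using ha⟩

theorem reduce_step {π : List ℕ} {p : ℕ} (hπ : IsPermList π) (hp : leftNonMin π = some p)
    (hl : numLRMin π + 2 ≤ π.length) :
    ∃ π', IsPermList π' ∧ PermEquiv pat123 pat13S π π' ∧ π'.length < π.length := by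
  obtain ⟨P, y, B, rfl, -, hA, hy⟩ := split_left hp
  have hlen := lrm_nrm_length (P ++ y :: B) []
  rw [numLRMin_eq] at hl
  have eN : nrm [] (P ++ y :: B) = y :: nrm (P ++ [y]) B := by
    rw [nrm_append, hA]; simp [nrm, hy]
  have eB : nrm (P ++ [y]) B ≠ [] := by
    intro e
    rw [eN, e] at hlen
    simp only [List.length_cons, List.length_nil] at hlen
    omega
  obtain ⟨C, z, D, rfl, hz⟩ := nrm_ne_nil _ _ eB
  have hnd : (P ++ y :: (C ++ z :: D)).Nodup := hπ.nodup_iff.2 List.nodup_range'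
  have hpos : ∀ k ∈ P ++ y :: (C ++ z :: D), 0 < k := by
    intro k hk
    have := hπ.subset hk
    rw [List.mem_range'_1] at this
    omega
  push Not at hy hz
  obtain ⟨x, hx, hxy⟩ := hy
  obtain ⟨x', hx', hxz⟩ := hz
  have hxy' : x < y := by
    refine lt_of_le_of_ne hxy ?_
    rintro rfl
    exact (List.nodup_append.1 hnd).2.2 x hx x (by simp) rfl
  have hxz' : x' < z := by
    refine lt_of_le_of_ne hxz ?_
    rintro rfl
    have : (P ++ [y] ++ C ++ x' :: D).Nodup := by simpa using hnd
    exact (List.nodup_append.1 this).2.2 x' hx' x' (by simp) rfl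
  have hyz : y ≠ z := by
    rintro rfl
    have := (List.nodup_cons.1 (List.nodup_append.1 hnd).2.1).1
    exact this (by simp)
  let f : ℕ → ℕ := (2 * ·)
  have hd := std_double hπ
  have hG : Good ((P ++ y :: (C ++ z :: D)).map f) := by
    refine ⟨hnd.map (fun a b h => by simp only [f] at h; omega), ?_⟩
    intro k hk
    obtain ⟨a, ha, rfl⟩ := List.mem_map.1 hk
    have := hpos a ha
    simp only [f]; omega
  have hE : (P ++ y :: (C ++ z :: D)).map f
      = P.map f ++ 2 * y :: (C.map f ++ 2 * z :: D.map f) := by simp [f]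
  change std ((P ++ y :: (C ++ z :: D)).map f) = _ at hd
  have hev : 2 * y - 1 ∉ (P ++ y :: (C ++ z :: D)).map f := by
    intro h
    obtain ⟨a, ha, e⟩ := List.mem_map.1 h
    have := hpos y (by simp)
    simp only [f] at e; omega
  rw [hE] at hd hG hev
  have hxf : 2 * x ∈ P.map f := List.mem_map.2 ⟨x, hx, rfl⟩
  rcases lt_or_gt_of_ne hyz with h | h
  · have hr : Red (P.map f ++ 2 * y :: (C.map f ++ 2 * z :: D.map f))
        (P.map f ++ 2 * z :: (C.map f ++ D.map f)) :=
      ⟨_, _, _, _, _, ⟨2 * x, hxf, by omega⟩, by omega, rfl, rfl⟩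
    refine ⟨_, std_perm (hr.good hG).1, ?_, ?_⟩
    · have := (hr.equiv hG).1
      rwa [hd] at this
    · simp [std]
  · set w := 2 * y - 1 with hw
    have hG1 : Good (P.map f ++ w :: (C.map f ++ 2 * z :: (D.map f ++ [2 * y]))) := by
      have hp : (P.map f ++ w :: (C.map f ++ 2 * z :: (D.map f ++ [2 * y]))).Perm
          (w :: (P.map f ++ 2 * y :: (C.map f ++ 2 * z :: D.map f))) := by
        refine List.perm_middle.trans (List.Perm.cons _ (List.Perm.append_left _ ?_))
        have := List.perm_append_singleton (2 * y) (C.map f ++ 2 * z :: D.map f)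
        simpa using this
      refine ⟨hp.nodup_iff.2 (List.nodup_cons.2 ⟨hev, hG.1⟩), ?_⟩
      intro k hk
      rcases List.mem_cons.1 (hp.subset hk) with rfl | hk
      · omega
      · exact hG.2 k hk
    have r1 : Red (P.map f ++ w :: (C.map f ++ 2 * z :: (D.map f ++ [2 * y])))
        (P.map f ++ 2 * y :: (C.map f ++ 2 * z :: D.map f)) :=
      ⟨P.map f, C.map f ++ 2 * z :: D.map f, [], w, 2 * y, ⟨2 * x, hxf, by omega⟩, by omega,
        by simp, by simp⟩
    have hx2 : 2 * x' ∈ P.map f ++ w :: C.map f := by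
      simp only [List.mem_append, List.mem_singleton] at hx'
      rcases hx' with (h1 | h1) | h1
      · exact List.mem_append_left _ (List.mem_map.2 ⟨x', h1, rfl⟩)
      · omega
      · exact List.mem_append_right _ (List.mem_cons_of_mem _ (List.mem_map.2 ⟨x', h1, rfl⟩))
    have r2 : Red (P.map f ++ w :: (C.map f ++ 2 * z :: (D.map f ++ [2 * y])))
        (P.map f ++ w :: (C.map f ++ 2 * y :: D.map f)) :=
      ⟨P.map f ++ w :: C.map f, D.map f, [], 2 * z, 2 * y, ⟨2 * x', hx2, by omega⟩, by omega,
        by simp, by simp⟩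
    have r3 : Red (P.map f ++ w :: (C.map f ++ 2 * y :: D.map f))
        (P.map f ++ 2 * y :: (C.map f ++ D.map f)) :=
      ⟨_, _, _, _, _, ⟨2 * x, hxf, by omega⟩, by omega, rfl, rfl⟩
    have hG2 := r2.good hG1
    refine ⟨_, std_perm (r3.good hG2).1, ?_, ?_⟩
    · have e1 := (r1.equiv hG1).2
      rw [hd] at e1
      exact (Relation.ReflTransGen.trans e1 (r2.equiv hG1).1).trans (r3.equiv hG2).1
    · simp [std]

theorem length_ge {σ : List ℕ} {p : ℕ} (hp : leftNonMin σ = some p) :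
    numLRMin σ + 1 ≤ σ.length := by
  obtain ⟨P, y, B, rfl, -, hA, hy⟩ := split_left hp
  have hlen := lrm_nrm_length (P ++ y :: B) []
  rw [numLRMin_eq]
  have eN : nrm [] (P ++ y :: B) = y :: nrm (P ++ [y]) B := by
    rw [nrm_append, hA]; simp [nrm, hy]
  rw [eN] at hlen
  simp only [List.length_cons] at hlen
  omega

theorem equiv_tau (n : ℕ) : ∀ (π : List ℕ) (p : ℕ), π.length = n → IsPermList π →
    leftNonMin π = some p → PermEquiv pat123 pat13S π (tau13 (numLRMin π) p (vStatMax π)) := by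
  induction n using Nat.strong_induction_on with
  | _ n ih =>
    intro π p hn hπ hp
    have h1 := length_ge hp
    by_cases h : π.length = numLRMin π + 1
    · rw [← unique_tau hπ h rfl hp rfl]
      exact Relation.ReflTransGen.refl
    · obtain ⟨π', hπ', he, hlt⟩ := reduce_step hπ hp (by omega)
      obtain ⟨e1, e2, e3⟩ := PermEquiv.sameInv he
      have := ih _ (by omega) π' p rfl hπ' (by rw [← e2, hp])
      rw [← e1, ← e3] at this
      exact Relation.ReflTransGen.trans he this

/-- let `π` have a non-left-to-right-minimum element, with `m`
left-to-right minima, leftmost non-left-to-right-minimum element at 0-indexed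
position `p` (i.e. position `p + 1` from the left), and `v` left-to-right minima
smaller than the largest non-left-to-right-minimum element. Then `π` is
equivalent under `123 ↔ 13★` to the permutation `τ` of length `m + 1` whose
`(p+1)`-th entry is `v + 1` and whose remaining entries are decreasing; every
permutation equivalent to `π` has length at least `m + 1`, and `τ` is the only
one of that length; thus `τ` is the primitive permutation of `π`. -/
theorem primitive_13star (π : List ℕ) (hπ : IsPermList π) (hnm : HasNonMin π)
    (p : ℕ) (hp : leftNonMin π = some p) :
    PermEquiv pat123 pat13S π (tau13 (numLRMin π) p (vStatMax π)) ∧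
    (∀ σ : List ℕ, IsPermList σ → PermEquiv pat123 pat13S π σ →
      numLRMin π + 1 ≤ σ.length ∧
      (σ.length = numLRMin π + 1 → σ = tau13 (numLRMin π) p (vStatMax π))) := by
  refine ⟨equiv_tau _ π p rfl hπ hp, fun σ hσ he => ?_⟩
  obtain ⟨e1, e2, e3⟩ := PermEquiv.sameInv he
  rw [hp] at e2
  refine ⟨?_, fun hl => unique_tau hσ hl e1.symm e2.symm e3.symm⟩
  rw [e1]
  exact length_ge e2.symm
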